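/- Let G be a connected claw-free graph on n vertices in which every vertex has degree at least 3, with a nonnegative weight w(v) assigned to each vertex v. Then G has a spanning tree T such that the sum of the weights of the internal vertices of T is at least (1/2 − 1/n) times the total weight of all vertices of G. -/

import Mathlib

open scoped Classical

/-- The total weight of internal vertices (degree at least 2) of a graph `T`. -/
noncomputable def internalWeight {V : Type*} [Fintype V] (T : SimpleGraph V) (w : V → ℝ) : ℝ :=
  ∑ v ∈ Finset.univ.filter (fun v => 2 ≤ T.degree v), w v

/-- A graph is claw-free if it has no induced `K_{1,3}`: among any three distinct neighbors
of a vertex, some two are adjacent. -/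
def ClawFree {V : Type*} (G : SimpleGraph V) : Prop :=
  ∀ v a b c : V, G.Adj v a → G.Adj v b → G.Adj v c → a ≠ b → a ≠ c → b ≠ c →
    G.Adj a b ∨ G.Adj a c ∨ G.Adj b c

namespace ClawTree

open SimpleGraph

variable {V : Type*}

/-- Delete the edge `bc`. -/
abbrev del (T : SimpleGraph V) (b c : V) : SimpleGraph V := T.deleteEdges {s(b, c)}

lemma del_adj {T : SimpleGraph V} {b c v w : V} :
    (del T b c).Adj v w ↔ T.Adj v w ∧ ¬ (v = b ∧ w = c) ∧ ¬ (v = c ∧ w = b) := by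
  simp [del, deleteEdges_adj]

lemma del_comm (T : SimpleGraph V) (b c : V) : del T b c = del T c b := by
  simp [del, Sym2.eq_swap]

lemma not_reach {T : SimpleGraph V} (hT : T.IsTree) {b c : V} (h : T.Adj b c) :
    ¬ (del T b c).Reachable b c := by
  have := isAcyclic_iff_forall_adj_isBridge.1 hT.isAcyclic h
  exact isBridge_iff.1 this

lemma reach_or {T : SimpleGraph V} (hT : T.Connected) (b c v : V) :
    (del T b c).Reachable v b ∨ (del T b c).Reachable v c := by
  obtain ⟨p⟩ := hT.preconnected v b
  induction p with
  | nil => exact Or.inl (Reachable.refl _)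
  | @cons u v w h p ih =>
    by_cases h1 : u = w
    · subst h1; exact Or.inl (Reachable.refl _)
    by_cases h2 : u = c
    · subst h2; exact Or.inr (Reachable.refl _)
    have h3 : (del T w c).Adj u v := by
      rw [del_adj]; exact ⟨h, fun h => h1 h.1, fun h => h2 h.1⟩
    rcases ih with ih | ih
    · exact Or.inl (h3.reachable.trans ih)
    · exact Or.inr (h3.reachable.trans ih)

/-- First step towards a target vertex. -/
lemma exists_step {T : SimpleGraph V} (hT : T.Connected) {u l : V} (h : u ≠ l) :
    ∃ x, T.Adj u x ∧ (del T u x).Reachable x l := by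
  obtain ⟨p, hp⟩ := hT.exists_isPath u l
  cases p with
  | nil => exact absurd rfl h
  | @cons _ x _ hux q =>
    rw [Walk.cons_isPath_iff] at hp
    refine ⟨x, hux, ⟨q.toDeleteEdges _ ?_⟩⟩
    intro e he h'
    rw [Set.mem_singleton_iff] at h'
    subst h'
    exact hp.2 (q.fst_mem_support_of_mem_edges he)

/-- Local structure of a path at an interior vertex. -/
lemma path_interior {T : SimpleGraph V} {l m b : V} (p : T.Walk l m) (hp : p.IsPath)
    (hb : b ∈ p.support) (hl : b ≠ l) (hm : b ≠ m) :
    ∃ c c', c ≠ c' ∧ T.Adj b c ∧ T.Adj b c' ∧ c ∈ p.support ∧ c' ∈ p.support ∧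
      (del T b c).Reachable l b ∧ (del T b c).Reachable m c := by
  classical
  obtain ⟨p0, p1, rfl⟩ := Walk.mem_support_iff_exists_append.1 hb
  have hnd := hp.support_nodup
  rw [Walk.support_append] at hnd
  rw [List.nodup_append] at hnd
  obtain ⟨h0, h1, h2⟩ := hnd
  cases p1 with
  | nil => exact absurd rfl hm
  | @cons _ c _ hbc q =>
    simp only [Walk.support_cons, List.tail_cons] at h1 h2
    have hcq : c ∈ q.support := q.start_mem_support
    have hbp : b ∈ p0.support := p0.end_mem_support
    have hc0 : c ∉ p0.support := fun h => h2 c h c hcq rfl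
    have hbq : b ∉ q.support := fun h => h2 b hbp b h rfl
    have hnn : ¬ p0.Nil := by
      intro h; exact hl h.eq.symm
    refine ⟨c, p0.penultimate, ?_, hbc, (p0.adj_penultimate hnn).symm, ?_, ?_, ?_, ?_⟩
    · rintro rfl
      exact hc0 (p0.getVert_mem_support _)
    · simp
    · rw [Walk.mem_support_append_iff]
      exact Or.inl (p0.getVert_mem_support _)
    · refine ⟨p0.toDeleteEdges _ ?_⟩
      intro e he h'
      rw [Set.mem_singleton_iff] at h'
      subst h'
      exact hc0 (p0.snd_mem_support_of_mem_edges he)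
    · refine Reachable.symm ⟨q.toDeleteEdges _ ?_⟩
      intro e he h'
      rw [Set.mem_singleton_iff] at h'
      subst h'
      exact hbq (q.fst_mem_support_of_mem_edges he)

variable [Fintype V]

lemma degree_del {T T0 : SimpleGraph V} {b c : V} (hbc : T.Adj b c)
    (h0 : ∀ v w, T0.Adj v w ↔ T.Adj v w ∧ ¬ (v = b ∧ w = c) ∧ ¬ (v = c ∧ w = b)) (v : V) :
    T0.degree v + (if v = b ∨ v = c then 1 else 0) = T.degree v := by
  have hne := hbc.ne
  by_cases h1 : v = b
  · subst h1
    have : T.neighborFinset v = insert c (T0.neighborFinset v) := by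
      ext w
      simp only [mem_neighborFinset, Finset.mem_insert, h0]
      constructor
      · intro h; by_cases hw : w = c
        · exact Or.inl hw
        · exact Or.inr ⟨h, by tauto, by tauto⟩
      · rintro (rfl | h)
        · exact hbc
        · exact h.1
    rw [← card_neighborFinset_eq_degree, ← card_neighborFinset_eq_degree, this,
      Finset.card_insert_of_notMem]
    · simp
    · simp [h0]
  by_cases h2 : v = c
  · subst h2
    have : T.neighborFinset v = insert b (T0.neighborFinset v) := by
      ext w
      simp only [mem_neighborFinset, Finset.mem_insert, h0]
      constructor
      · intro h; by_cases hw : w = b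
        · exact Or.inl hw
        · exact Or.inr ⟨h, by tauto, by tauto⟩
      · rintro (rfl | h)
        · exact hbc.symm
        · exact h.1
    rw [← card_neighborFinset_eq_degree, ← card_neighborFinset_eq_degree, this,
      Finset.card_insert_of_notMem]
    · simp
    · simp [h0]
  · have : T.neighborFinset v = T0.neighborFinset v := by
      ext w
      simp only [mem_neighborFinset, h0]
      tauto
    rw [← card_neighborFinset_eq_degree, ← card_neighborFinset_eq_degree, this]
    simp [h1, h2]

/-- Exchange of tree edges. -/
lemma swap {G T : SimpleGraph V} (hTG : T ≤ G) (hT : T.IsTree) {b c p q : V} (hbc : T.Adj b c)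
    (hp : (del T b c).Reachable p b) (hq : (del T b c).Reachable q c) (hpq : G.Adj p q) :
    ∃ T' : SimpleGraph V, T' ≤ G ∧ T'.IsTree ∧
      ∀ v, T'.degree v + (if v = b ∨ v = c then 1 else 0) =
        T.degree v + (if v = p ∨ v = q then 1 else 0) := by
  have hnr : ¬ (del T b c).Reachable p q := fun h =>
    not_reach hT hbc ((hp.symm.trans h).trans hq)
  have hle : del T b c ≤ T := deleteEdges_le _
  have hadj : (del T b c ⊔ edge p q).Adj p q := by
    right; rw [edge_adj]; exact ⟨Or.inl ⟨rfl, rfl⟩, hpq.ne⟩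
  have hmono : del T b c ≤ del T b c ⊔ edge p q := le_sup_left
  refine ⟨del T b c ⊔ edge p q, ?_, ⟨?_, ?_⟩, ?_⟩
  · refine sup_le (hle.trans hTG) ?_
    intro v w h
    rw [edge_adj] at h
    rcases h with ⟨⟨rfl, rfl⟩ | ⟨rfl, rfl⟩, -⟩
    · exact hpq
    · exact hpq.symm
  · have : Nonempty V := ⟨b⟩
    have key : ∀ v, (del T b c ⊔ edge p q).Reachable v p := by
      intro v
      rcases reach_or hT.connected b c v with h | h
      · exact (h.trans hp.symm).mono hmono
      · exact ((h.trans hq.symm).mono hmono).trans hadj.symm.reachable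
    exact ⟨fun v w => (key v).trans (key w).symm⟩
  · exact (hT.isAcyclic.anti hle).sup_edge_of_not_reachable hnr
  · intro v
    have hd := degree_del (T := T) (T0 := del T b c) hbc (fun v w => del_adj) v
    have hd' := degree_del (T := del T b c ⊔ edge p q) (T0 := del T b c) hadj (fun v w => by
      rw [sup_adj, edge_adj]
      constructor
      · intro h
        refine ⟨Or.inl h, ?_, ?_⟩
        · rintro ⟨rfl, rfl⟩; exact hnr h.reachable
        · rintro ⟨rfl, rfl⟩; exact hnr h.symm.reachable
      · tauto) v
    omega

/-- Leaves. -/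
noncomputable def lv (T : SimpleGraph V) : Finset V :=
  Finset.univ.filter (fun v => T.degree v < 2)

lemma mem_lv {T : SimpleGraph V} {v : V} : v ∈ lv T ↔ T.degree v < 2 := by simp [lv]

/-- `T` is a spanning tree with the fewest leaves. -/
def MinLeaf (G T : SimpleGraph V) : Prop :=
  T ≤ G ∧ T.IsTree ∧ ∀ T' ≤ G, T'.IsTree → (lv T).card ≤ (lv T').card

lemma two_le_degree {T : SimpleGraph V} {v a b : V} (hab : a ≠ b) (ha : T.Adj v a)
    (hb : T.Adj v b) : 2 ≤ T.degree v := by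
  rw [← card_neighborFinset_eq_degree, ← Finset.card_pair hab]
  apply Finset.card_le_card
  intro x
  simp only [Finset.mem_insert, Finset.mem_singleton, mem_neighborFinset]
  rintro (rfl | rfl) <;> assumption

lemma three_le_degree {T : SimpleGraph V} {v a b c : V} (hab : a ≠ b) (hac : a ≠ c)
    (hbc : b ≠ c) (ha : T.Adj v a) (hb : T.Adj v b) (hc : T.Adj v c) : 3 ≤ T.degree v := by
  have h3 : ({a, b, c} : Finset V).card = 3 := Finset.card_eq_three.2 ⟨a, b, c, hab, hac, hbc, rfl⟩
  rw [← card_neighborFinset_eq_degree, ← h3]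
  apply Finset.card_le_card
  intro x
  simp only [Finset.mem_insert, Finset.mem_singleton, mem_neighborFinset]
  rintro (rfl | rfl | rfl) <;> assumption

/-- In a tree with the fewest leaves and at least three leaves, leaves are independent. -/
lemma leaves_indep {G T : SimpleGraph V} (hT : MinLeaf G T) {l m k : V} (hl : l ∈ lv T)
    (hm : m ∈ lv T) (hk : k ∈ lv T) (hlm : l ≠ m) (hkl : k ≠ l) (hkm : k ≠ m) :
    ¬ G.Adj l m := by
  intro hG
  obtain ⟨hTG, hTt, hmin⟩ := hT
  obtain ⟨p, hp⟩ := hTt.connected.exists_isPath l m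
  have hkS : k ∉ p.support := by
    intro h
    obtain ⟨c, c', hcc, h1, h2, -⟩ := path_interior p hp h hkl hkm
    have := two_le_degree hcc h1 h2
    have := mem_lv.1 hk
    omega
  obtain ⟨q⟩ := hTt.connected.preconnected l k
  obtain ⟨⟨⟨b, z⟩, hbz⟩, -, hbS, hzS⟩ :=
    q.exists_boundary_dart {v | v ∈ p.support} p.start_mem_support hkS
  simp only [Set.mem_ofPred_eq] at hbS hzS hbz
  have hnn : ¬ p.Nil := fun h => hlm h.eq
  have hbl : b ≠ l := by
    rintro rfl
    have : z ≠ p.snd := by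
      rintro rfl
      exact hzS (p.getVert_mem_support _)
    have := two_le_degree this hbz (p.adj_snd hnn)
    have := mem_lv.1 hl
    omega
  have hbm : b ≠ m := by
    rintro rfl
    have : z ≠ p.penultimate := by
      rintro rfl
      exact hzS (p.getVert_mem_support _)
    have := two_le_degree this hbz (p.adj_penultimate hnn).symm
    have := mem_lv.1 hm
    omega
  obtain ⟨c, c', hcc, h1, h2, h3, h4, h5, h6⟩ := path_interior p hp hbS hbl hbm
  have hdb : 3 ≤ T.degree b := three_le_degree hcc (fun h : c = z => hzS (h ▸ h3))
    (fun h : c' = z => hzS (h ▸ h4)) h1 h2 hbz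
  obtain ⟨T', hT'G, hT't, hd⟩ := swap hTG hTt h1 h5 h6 hG
  have hc1 : 1 ≤ T.degree l := by
    rw [← card_neighborFinset_eq_degree]
    exact Finset.card_pos.2 ⟨_, (mem_neighborFinset _ _ _).2 (p.adj_snd hnn)⟩
  have hc2 : 1 ≤ T.degree m := by
    rw [← card_neighborFinset_eq_degree]
    exact Finset.card_pos.2 ⟨_, (mem_neighborFinset _ _ _).2 (p.adj_penultimate hnn).symm⟩
  have hsub : lv T' ⊆ insert c (((lv T).erase l).erase m) := by
    intro v hv
    rw [mem_lv] at hv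
    simp only [Finset.mem_insert, Finset.mem_erase, mem_lv]
    by_cases hvc : v = c
    · exact Or.inl hvc
    right
    have h := hd v
    by_cases hvb : v = b
    · subst hvb
      simp [hbl, hbm] at h
      omega
    simp only [hvb, hvc, or_self, if_false] at h
    refine ⟨?_, ?_, ?_⟩
    · rintro rfl
      simp at h; omega
    · rintro rfl
      simp at h; omega
    · omega
  have e1 := Finset.card_le_card hsub
  have e2 := Finset.card_insert_le c (((lv T).erase l).erase m)
  have e3 : m ∈ (lv T).erase l := Finset.mem_erase.2 ⟨hlm.symm, hm⟩
  have e4 := Finset.card_erase_lt_of_mem e3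
  have e5 := Finset.card_erase_lt_of_mem hl
  have := hmin T' hT'G hT't
  omega

/-- The leaf `l` charges `x` through its non-tree neighbour `u`. -/
def Ch (G T : SimpleGraph V) (l u x : V) : Prop :=
  l ∈ lv T ∧ G.Adj l u ∧ ¬ T.Adj l u ∧ T.Adj u x ∧ (del T u x).Reachable x l

lemma Ch.ne {G T : SimpleGraph V} {l u x : V} (h : Ch G T l u x) : x ≠ l := by
  rintro rfl
  exact h.2.2.1 h.2.2.2.1.symm

lemma Ch.other {G T : SimpleGraph V} (hT : T.IsTree) {l u x : V} (h : Ch G T l u x) :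
    ∃ y, T.Adj x y ∧ y ≠ u ∧ (del T x y).Reachable y l := by
  obtain ⟨y, h1, h2⟩ := exists_step hT.connected h.ne
  refine ⟨y, h1, ?_, h2⟩
  rintro rfl
  rw [del_comm] at h2
  exact not_reach hT h.2.2.2.1 (h2.trans h.2.2.2.2.symm)

lemma Ch.swap {G T : SimpleGraph V} (hTG : T ≤ G) (hT : T.IsTree) {l u x : V}
    (h : Ch G T l u x) : ∃ T' : SimpleGraph V, T' ≤ G ∧ T'.IsTree ∧
      (∀ v, T'.degree v + (if v = x then 1 else 0) = T.degree v + (if v = l then 1 else 0)) ∧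
      lv T' ⊆ insert x ((lv T).erase l) := by
  obtain ⟨T', h1, h2, h3⟩ := ClawTree.swap hTG hT h.2.2.2.1 (Reachable.refl u)
    h.2.2.2.2.symm h.2.1.symm
  have hlu := h.2.1.ne
  have hux := h.2.2.2.1.ne
  have hxl := h.ne
  have hd : ∀ v, T'.degree v + (if v = x then 1 else 0) =
      T.degree v + (if v = l then 1 else 0) := by
    intro v
    have := h3 v
    by_cases e : v = u
    · subst e
      simp [hux, hlu.symm] at this ⊢
      exact this
    · simpa [e] using this
  refine ⟨T', h1, h2, hd, ?_⟩
  intro v hv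
  rw [mem_lv] at hv
  simp only [Finset.mem_insert, Finset.mem_erase, mem_lv]
  by_cases hvx : v = x
  · exact Or.inl hvx
  right
  have h := hd v
  simp only [hvx, if_false] at h
  refine ⟨?_, by omega⟩
  rintro rfl
  have hpos : 1 ≤ T.degree v := by
    obtain ⟨y, hy, -⟩ := exists_step hT.connected hlu
    rw [← card_neighborFinset_eq_degree]
    exact Finset.card_pos.2 ⟨_, (mem_neighborFinset _ _ _).2 hy⟩
  simp at h; omega

lemma Ch.degree {G T : SimpleGraph V} (hT : MinLeaf G T) {l u x : V} (h : Ch G T l u x) :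
    T.degree x = 2 := by
  obtain ⟨y, hy, hyu, -⟩ := h.other hT.2.1
  have h2 := two_le_degree hyu hy h.2.2.2.1.symm
  by_contra hne
  obtain ⟨T', h1, h2, h3, h4⟩ := h.swap hT.1 hT.2.1
  have hx := h3 x
  simp only [if_true, h.ne, if_false] at hx
  have hxT' : x ∉ lv T' := by rw [mem_lv]; omega
  have hsub : lv T' ⊆ (lv T).erase l := by
    intro v hv
    rcases Finset.mem_insert.1 (h4 hv) with rfl | h'
    · exact absurd hv hxT'
    · exact h'
  have e1 := Finset.card_le_card hsub
  have e5 := Finset.card_erase_lt_of_mem h.1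
  have := hT.2.2 T' h1 h2
  omega

lemma Ch.nbr {G T : SimpleGraph V} (hT : MinLeaf G T) {l u x a b : V} (h : Ch G T l u x)
    (ha : T.Adj x a) (hb : T.Adj x b) (hau : a ≠ u) (hbu : b ≠ u) : a = b := by
  by_contra hab
  have := three_le_degree hau.symm hbu.symm hab h.2.2.2.1.symm ha hb
  have := h.degree hT
  omega

lemma Ch.inj {G T : SimpleGraph V} (hT : MinLeaf G T) {l u u' x : V} (h : Ch G T l u x)
    (h' : Ch G T l u' x) : u = u' := by
  by_contra hne
  obtain ⟨y, hy, hyu, hr⟩ := h.other hT.2.1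
  have := h.nbr hT hy h'.2.2.2.1.symm hyu (Ne.symm hne)
  subst this
  rw [del_comm] at hr
  exact not_reach hT.2.1 h'.2.2.2.1 (hr.trans h'.2.2.2.2.symm)

lemma no_two_one {G T : SimpleGraph V} (hcf : ClawFree G) (hT : MinLeaf G T)
    {l l' m u u' x : V} (h1 : Ch G T l u x) (h2 : Ch G T l' u x) (h3 : Ch G T m u' x)
    (hll : l ≠ l') (hlm : l ≠ m) (hlm' : l' ≠ m) : False := by
  have i1 := leaves_indep hT h1.1 h2.1 h3.1 hll hlm.symm hlm'.symm
  have i2 := leaves_indep hT h1.1 h3.1 h2.1 hlm hll.symm hlm'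
  have i3 := leaves_indep hT h2.1 h3.1 h1.1 hlm' hll hlm
  by_cases huu : u' = u
  · subst huu
    rcases hcf u' l l' m h1.2.1.symm h2.2.1.symm h3.2.1.symm hll hlm hlm' with h | h | h
    · exact i1 h
    · exact i2 h
    · exact i3 h
  obtain ⟨T1, g1, g2, g3, g4⟩ := h3.swap hT.1 hT.2.1
  have hm1 : MinLeaf G T1 := by
    refine ⟨g1, g2, fun T' a b => ?_⟩
    have e1 := Finset.card_le_card g4
    have e2 := Finset.card_insert_le x ((lv T).erase m)
    have e5 := Finset.card_erase_lt_of_mem h3.1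
    have := hT.2.2 T' a b
    omega
  have hx : x ∈ lv T1 := by
    have := g3 x
    have := h3.degree hT
    simp only [if_true, h3.ne, if_false] at *
    rw [mem_lv]; omega
  have hl : l ∈ lv T1 := by
    have := g3 l
    have := mem_lv.1 h1.1
    simp only [h1.ne.symm, hlm, if_false] at *
    rw [mem_lv]; omega
  have hl' : l' ∈ lv T1 := by
    have := g3 l'
    have := mem_lv.1 h2.1
    simp only [h2.ne.symm, hlm', if_false] at *
    rw [mem_lv]; omega
  rcases hcf u x l l' (hT.1 h1.2.2.2.1) h1.2.1.symm h2.2.1.symm h1.ne h2.ne hll with h | h | h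
  · exact leaves_indep hm1 hx hl hl' h1.ne h2.ne.symm hll.symm h
  · exact leaves_indep hm1 hx hl' hl h2.ne h1.ne.symm hll h
  · exact i1 h

lemma charges_le {G T : SimpleGraph V} (hcf : ClawFree G) (hT : MinLeaf G T) (x : V) :
    ((lv T).filter (fun l => ∃ u, Ch G T l u x)).card ≤ 2 := by
  by_contra hlt
  push Not at hlt
  obtain ⟨a, b, c, ha, hb, hc, hab, hac, hbc⟩ := Finset.two_lt_card_iff.1 hlt
  obtain ⟨-, u, hu⟩ := Finset.mem_filter.1 ha
  obtain ⟨-, v, hv⟩ := Finset.mem_filter.1 hb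
  obtain ⟨-, w, hw⟩ := Finset.mem_filter.1 hc
  by_cases h1 : v = u
  · subst h1
    exact no_two_one hcf hT hu hv hw hab hac hbc
  by_cases h2 : w = u
  · subst h2
    exact no_two_one hcf hT hu hw hv hac hab hbc.symm
  have := hu.nbr hT hv.2.2.2.1.symm hw.2.2.2.1.symm h1 h2
  subst this
  exact no_two_one hcf hT hv hw hu hbc hab.symm hac.symm

lemma le_charges {G T : SimpleGraph V} (hdeg : ∀ v : V, 3 ≤ G.degree v) (hT : MinLeaf G T)
    {l : V} (hl : l ∈ lv T) :
    2 ≤ ((lv T)ᶜ.filter (fun x => ∃ u, Ch G T l u x)).card := by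
  have h1 : ∀ u ∈ G.neighborFinset l \ T.neighborFinset l, ∃ x, Ch G T l u x := by
    intro u hu
    simp only [Finset.mem_sdiff, mem_neighborFinset] at hu
    obtain ⟨x, hx, hr⟩ := exists_step hT.2.1.connected hu.1.ne.symm
    exact ⟨x, hl, hu.1, hu.2, hx, hr⟩
  choose! f hf using h1
  have h2 : 2 ≤ (G.neighborFinset l \ T.neighborFinset l).card := by
    have := Finset.le_card_sdiff (T.neighborFinset l) (G.neighborFinset l)
    rw [card_neighborFinset_eq_degree, card_neighborFinset_eq_degree] at this
    have := hdeg l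
    have := mem_lv.1 hl
    omega
  refine h2.trans (Finset.card_le_card_of_injOn f ?_ ?_)
  · intro u hu
    have hc := hf u hu
    have := hc.degree hT
    simp only [Finset.coe_filter, Set.mem_ofPred_eq, Finset.mem_compl, mem_lv]
    exact ⟨by omega, u, hc⟩
  · intro u hu u' hu' he
    have hc := hf u hu
    have hc' := hf u' hu'
    rw [← he] at hc'
    exact hc.inj hT hc'

end ClawTree

theorem clawfree_spanning_tree_internal_weight_half
    {V : Type*} [Fintype V] (G : SimpleGraph V)
    (hconn : G.Connected) (hcf : ClawFree G) (hdeg : ∀ v : V, 3 ≤ G.degree v)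
    (w : V → ℝ) (hw : ∀ v : V, 0 ≤ w v) :
    ∃ T : SimpleGraph V, T ≤ G ∧ T.IsTree ∧
      (1 / 2 - 1 / (Fintype.card V : ℝ)) * (∑ v : V, w v) ≤ internalWeight T w := by
  open ClawTree in
  obtain ⟨S, hSG, hS⟩ := hconn.exists_isTree_le
  obtain ⟨T0, hT0, hmin0⟩ := Finset.exists_min_image
    (Finset.univ.filter (fun T : SimpleGraph V => T ≤ G ∧ T.IsTree)) (fun T => (lv T).card)
    ⟨S, by simp [hSG, hS]⟩
  simp only [Finset.mem_filter, Finset.mem_univ, true_and] at hT0 hmin0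
  have hM0 : MinLeaf G T0 := ⟨hT0.1, hT0.2, fun T' a b => hmin0 T' ⟨a, b⟩⟩
  obtain ⟨T, hT, hmin⟩ := Finset.exists_min_image
    (Finset.univ.filter (fun T : SimpleGraph V => MinLeaf G T)) (fun T => ∑ v ∈ lv T, w v)
    ⟨T0, by simp [hM0]⟩
  simp only [Finset.mem_filter, Finset.mem_univ, true_and] at hT hmin
  refine ⟨T, hT.1, hT.2.1, ?_⟩
  have hwx : ∀ l u x, Ch G T l u x → w l ≤ w x := by
    intro l u x h
    obtain ⟨T1, g1, g2, g3, g4⟩ := h.swap hT.1 hT.2.1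
    have hm1 : MinLeaf G T1 := by
      refine ⟨g1, g2, fun T' a b => ?_⟩
      have e1 := Finset.card_le_card g4
      have e2 := Finset.card_insert_le x ((lv T).erase l)
      have e5 := Finset.card_erase_lt_of_mem h.1
      have := hT.2.2 T' a b
      omega
    have e1 := hmin T1 hm1
    have e2 : ∑ v ∈ lv T1, w v ≤ ∑ v ∈ insert x ((lv T).erase l), w v :=
      Finset.sum_le_sum_of_subset_of_nonneg g4 (fun i _ _ => hw i)
    have hx : x ∉ (lv T).erase l := by
      intro h'
      have := mem_lv.1 (Finset.mem_erase.1 h').2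
      have := h.degree hT
      omega
    rw [Finset.sum_insert hx] at e2
    have e3 := Finset.add_sum_erase (lv T) w h.1
    linarith
  have hI : internalWeight T w = ∑ v ∈ (lv T)ᶜ, w v := by
    unfold internalWeight
    apply Finset.sum_congr _ (fun _ _ => rfl)
    ext v
    simp [mem_lv, Nat.succ_le_iff]
  have htot : ∑ v ∈ lv T, w v + ∑ v ∈ (lv T)ᶜ, w v = ∑ v, w v := Finset.sum_add_sum_compl _ _
  have hkey : ∑ l ∈ lv T, 2 * w l ≤ ∑ x ∈ (lv T)ᶜ, 2 * w x := by
    calc ∑ l ∈ lv T, 2 * w l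
        ≤ ∑ l ∈ lv T, ∑ x ∈ (lv T)ᶜ, if ∃ u, Ch G T l u x then w x else 0 := by
          apply Finset.sum_le_sum
          intro l hl
          rw [← Finset.sum_filter]
          have h2 : (2 : ℝ) ≤ (((lv T)ᶜ.filter (fun x => ∃ u, Ch G T l u x)).card : ℝ) := by
            exact_mod_cast le_charges hdeg hT hl
          have h3 := Finset.card_nsmul_le_sum ((lv T)ᶜ.filter (fun x => ∃ u, Ch G T l u x)) w (w l)
            (fun x hx => by
              obtain ⟨-, u, hu⟩ := Finset.mem_filter.1 hx
              exact hwx l u x hu)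
          rw [nsmul_eq_mul] at h3
          exact (mul_le_mul_of_nonneg_right h2 (hw l)).trans h3
      _ = ∑ x ∈ (lv T)ᶜ, ∑ l ∈ lv T, if ∃ u, Ch G T l u x then w x else 0 := Finset.sum_comm
      _ ≤ ∑ x ∈ (lv T)ᶜ, 2 * w x := by
          apply Finset.sum_le_sum
          intro x hx
          rw [← Finset.sum_filter, Finset.sum_const, nsmul_eq_mul]
          apply mul_le_mul_of_nonneg_right _ (hw x)
          exact_mod_cast charges_le hcf hT x
  rw [← Finset.mul_sum, ← Finset.mul_sum] at hkey
  have hpos : 0 ≤ (1 / (Fintype.card V : ℝ)) * ∑ v, w v :=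
    mul_nonneg (by positivity) (Finset.sum_nonneg fun v _ => hw v)
  rw [hI, sub_mul]
  linarith
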